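/- If a prediction rule Ŷ satisfies demographic parity (Ŷ ⟂ S) and its distribution equals P_{Y|S=s_max}, then in the noiseless regime its conditional risk given S = s_max can be made 0 via optimal coupling, and its conditional risk given S = s_min is at least TV(P_{Y|S=s_max}, P_{Y|S=s_min}); therefore the total risk of this rule is exactly P(S = s_min)·TV(P_{Y|S=0}, P_{Y|S=1}) under optimal couplings. -/

import Mathlib

/-- The probability of disagreement under any coupling `M` of `a` and `b` is at least their
total variation distance. -/
theorem half_sum_abs_sub_le_coupling_ne
    {α : Type*} [Fintype α] [DecidableEq α] (a b : α → ℝ) (M : α × α → ℝ)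
    (hM : ∀ z, 0 ≤ M z) (hfst : ∀ x, ∑ y, M (x, y) = a x) (hsnd : ∀ y, ∑ x, M (x, y) = b y) :
    (1 / 2) * ∑ y, |a y - b y| ≤ ∑ z : α × α, if z.1 ≠ z.2 then M z else 0 := by
  have hpt (y : α) : |a y - b y| ≤
      ∑ x, ((if y ≠ x then M (y, x) else 0) + if x ≠ y then M (x, y) else 0) := by
    rw [← hfst y, ← hsnd y, ← Finset.sum_sub_distrib]
    refine (Finset.abs_sum_le_sum_abs _ _).trans (Finset.sum_le_sum fun x _ => ?_)
    by_cases h : x = y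
    · simp [h]
    · rw [if_pos (Ne.symm h), if_pos h, abs_le]
      constructor <;> linarith [hM (x, y), hM (y, x)]
  have hsum := Finset.sum_le_sum fun y (_ : y ∈ Finset.univ) => hpt y
  simp only [Finset.sum_add_distrib] at hsum
  rw [Finset.sum_comm (f := fun y x => if x ≠ y then M (x, y) else 0)] at hsum
  rw [Fintype.sum_prod_type]
  dsimp only
  linarith

/-- Two probability vectors on a finite type admit a coupling whose probability of disagreement
equals their total variation distance. -/
theorem exists_coupling_ne_eq_half_sum_abs_sub
    {α : Type*} [Fintype α] [DecidableEq α] (a b : α → ℝ)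
    (ha : ∀ x, 0 ≤ a x) (hb : ∀ x, 0 ≤ b x) (hab : ∑ x, a x = ∑ x, b x) :
    ∃ M : α × α → ℝ, (∀ z, 0 ≤ M z) ∧
      (∀ x, ∑ y, M (x, y) = a x) ∧ (∀ y, ∑ x, M (x, y) = b y) ∧
      (∑ z : α × α, if z.1 ≠ z.2 then M z else 0) = (1 / 2) * ∑ y, |a y - b y| := by
  set u : α → ℝ := fun x => a x - min (a x) (b x) with hu
  set v : α → ℝ := fun x => b x - min (a x) (b x) with hv
  set T : ℝ := ∑ x, u x with hT
  have hu0 (x : α) : 0 ≤ u x := sub_nonneg.2 (min_le_left _ _)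
  have hv0 (x : α) : 0 ≤ v x := sub_nonneg.2 (min_le_right _ _)
  have hvT : ∑ x, v x = T := by simp only [hT, hu, hv, Finset.sum_sub_distrib, hab]
  have huv (x : α) : u x * v x = 0 := by
    rcases le_total (a x) (b x) with h | h <;> simp [hu, hv, h]
  have habs (x : α) : |a x - b x| = u x + v x := by
    rcases le_total (a x) (b x) with h | h
    · simp [hu, hv, h, abs_of_nonpos]
    · simp [hu, hv, h, abs_of_nonneg]
  have hTV : (1 / 2) * ∑ y, |a y - b y| = T := by
    simp only [habs, Finset.sum_add_distrib, hvT, ← hT]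
    ring
  have hT0 : 0 ≤ T := Finset.sum_nonneg fun x _ => hu0 x
  have hcancel (w : α → ℝ) (hw : ∀ x, 0 ≤ w x) (hwT : ∑ x, w x = T) (x : α) :
      w x * T / T = w x := by
    rcases eq_or_ne T 0 with h | h
    · have := (Finset.sum_eq_zero_iff_of_nonneg fun x _ => hw x).1 (hwT.trans h) x
        (Finset.mem_univ x)
      simp [this]
    · exact mul_div_cancel_right₀ _ h
  refine ⟨fun z => (if z.1 = z.2 then min (a z.1) (b z.1) else 0) + u z.1 * v z.2 / T,
    fun z => ?_, fun x => ?_, fun y => ?_, ?_⟩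
  · refine add_nonneg ?_ (div_nonneg (mul_nonneg (hu0 _) (hv0 _)) hT0)
    split_ifs
    exacts [le_min (ha _) (hb _), le_rfl]
  · simp only [Finset.sum_add_distrib, Finset.sum_ite_eq, Finset.mem_univ, if_true,
      ← Finset.sum_div, ← Finset.mul_sum, hvT, hcancel u hu0 rfl]
    simp [hu]
  · simp only [Finset.sum_add_distrib, Finset.sum_ite_eq', Finset.mem_univ, if_true,
      ← Finset.sum_div, ← Finset.sum_mul, ← hT, mul_comm T, hcancel v hv0 hvT]
    simp [hv]
  · have hterm (z : α × α) : (if z.1 ≠ z.2 then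
        (if z.1 = z.2 then min (a z.1) (b z.1) else 0) + u z.1 * v z.2 / T else 0) =
        u z.1 * v z.2 / T := by
      by_cases h : z.1 = z.2
      · simp [h, huv]
      · simp [h]
    simp only [hterm]
    simp only [Fintype.sum_prod_type, ← Finset.sum_div, ← Finset.mul_sum, hvT,
      ← Finset.sum_mul, ← hT, mul_self_div_self, hTV]


/-- Binary S with majority outcome `smax` (`p smax ≥ 1/2`) and
conditional label distributions `q s = P_{Y|S=s}` on finite 𝒴. A
demographic-parity rule whose output distribution equals `q smax` satisfies:
(i) its conditional risk given S = smax can be made 0 via an optimal coupling;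
(ii) its conditional risk given S = smin is at least `TV(q smax, q smin)` under
every coupling; and (iii) there exist couplings (one per group, of the output
distribution `q smax` with `q s`) under which the total risk is exactly
`P(S = smin) · TV(q false, q true)`. -/
theorem dp_rule_matching_majority_risk
    {𝒴 : Type*} [Fintype 𝒴] [DecidableEq 𝒴]
    (p : Bool → ℝ) (hp0 : ∀ s, 0 ≤ p s) (hp1 : p false + p true = 1)
    (smax : Bool) (hmaj : (1 : ℝ) / 2 ≤ p smax)
    (q : Bool → 𝒴 → ℝ)
    (hq0 : ∀ s y, 0 ≤ q s y) (hq1 : ∀ s, ∑ y, q s y = 1) :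
    -- (i) zero conditional risk achievable on the majority group
    (∃ M : 𝒴 × 𝒴 → ℝ, (∀ z, 0 ≤ M z) ∧
      (∀ yh, ∑ y, M (yh, y) = q smax yh) ∧
      (∀ y, ∑ yh, M (yh, y) = q smax y) ∧
      (∑ z : 𝒴 × 𝒴, if z.1 ≠ z.2 then M z else 0) = 0) ∧
    -- (ii) conditional risk on the minority group at least TV under any coupling
    (∀ M : 𝒴 × 𝒴 → ℝ, (∀ z, 0 ≤ M z) →
      (∀ yh, ∑ y, M (yh, y) = q smax yh) →
      (∀ y, ∑ yh, M (yh, y) = q (!smax) y) →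
      (∑ z : 𝒴 × 𝒴, if z.1 ≠ z.2 then M z else 0) ≥
        (1 / 2) * ∑ y, |q smax y - q (!smax) y|) ∧
    -- (iii) total risk exactly P(S = smin) · TV(q false, q true) under optimal couplings
    (∃ M : Bool → 𝒴 × 𝒴 → ℝ,
      (∀ s z, 0 ≤ M s z) ∧
      (∀ s yh, ∑ y, M s (yh, y) = q smax yh) ∧
      (∀ s y, ∑ yh, M s (yh, y) = q s y) ∧
      (∑ s, p s * ∑ z : 𝒴 × 𝒴, if z.1 ≠ z.2 then M s z else 0) =
        p (!smax) * ((1 / 2) * ∑ y, |q false y - q true y|)) := by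
  choose M hM0 hMfst hMsnd hMne using fun s =>
    exists_coupling_ne_eq_half_sum_abs_sub (q smax) (q s) (hq0 smax) (hq0 s)
      ((hq1 smax).trans (hq1 s).symm)
  refine ⟨⟨M smax, hM0 smax, hMfst smax, hMsnd smax, ?_⟩, fun N hN hfst hsnd =>
    half_sum_abs_sub_le_coupling_ne _ _ N hN hfst hsnd, M, hM0, hMfst, hMsnd, ?_⟩
  · rw [hMne smax]
    simp
  · simp only [hMne]
    cases smax <;> simp [abs_sub_comm (q true _)]
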